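/- arXiv:1402.0829 — 2 statements merged into one kernel-verified Lean document; each statement's English description precedes it below -/
import Mathlib

section
/- The bound in the previous estimate is sharp: for every concave modulus of continuity ω with ∫₀^ε ω(t)/t dt < ∞, sup over f ∈ H_ω with zero mean of ‖f̃‖_C equals (1/π) ∫₀^{π/2} ω(2t)/sin t dt, i.e., there is a sequence (in fact an extremal function) in the class whose conjugate attains sup norm equal to this integral. -/
open MeasureTheory Real Filter Set

noncomputable section

/-- ω is a concave modulus of continuity. -/
def IsConcaveModulus (ω : ℝ → ℝ) : Prop :=
  Continuous ω ∧ MonotoneOn ω (Ici 0) ∧ ω 0 = 0 ∧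
    (∀ s t : ℝ, 0 ≤ s → 0 ≤ t → ω (s + t) ≤ ω s + ω t) ∧
    (∀ t : ℝ, 0 ≤ t → 0 ≤ ω t) ∧ ConcaveOn ℝ (Ici 0) ω

/-- The Dini condition: ∫₀^ε ω(t)/t dt < ∞ for some ε > 0. -/
def DiniCondition (ω : ℝ → ℝ) : Prop :=
  ∃ ε > 0, IntegrableOn (fun t => ω t / t) (Ioo 0 ε)

/-- f is 2π-periodic with modulus of continuity bounded by ω. -/
def MemH (ω f : ℝ → ℝ) : Prop :=
  Function.Periodic f (2 * π) ∧ ∀ x y : ℝ, |f x - f y| ≤ ω |x - y|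

/-- The principal value integral defining the conjugate function converges to L at x. -/
def ConjAt (f : ℝ → ℝ) (x L : ℝ) : Prop :=
  Tendsto (fun δ : ℝ =>
      -(1 / π) * ∫ t in {t : ℝ | δ ≤ |t - x| ∧ |t - x| ≤ π},
        f t / (2 * Real.tan ((t - x) / 2)))
    (nhdsWithin 0 (Ioi 0)) (nhds L)

/-- g is the trigonometric conjugate of f. -/
def ConjFn (f g : ℝ → ℝ) : Prop := ∀ x : ℝ, ConjAt f x (g x)

/-- f belongs to W^r H_ω. -/
def MemWrH (r : ℕ) (ω f : ℝ → ℝ) : Prop :=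
  Function.Periodic f (2 * π) ∧ ContDiff ℝ r f ∧
    ∀ x y : ℝ, |iteratedDeriv r f x - iteratedDeriv r f y| ≤ ω |x - y|

/-- The conjugate kernel `1 / (2 tan (u / 2))`. -/
def conjKernel (u : ℝ) : ℝ := 1 / (2 * Real.tan (u / 2))

lemma conjKernel_eq (u : ℝ) : conjKernel u = Real.cos (u / 2) / (2 * Real.sin (u / 2)) := by
  rw [conjKernel, Real.tan_eq_sin_div_cos, ← mul_div_assoc, one_div_div]

lemma conjKernel_neg (u : ℝ) : conjKernel (-u) = -conjKernel u := by
  simp [conjKernel_eq, neg_div, div_neg]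

lemma measurable_conjKernel : Measurable conjKernel := by
  have : conjKernel = fun u => Real.cos (u / 2) / (2 * Real.sin (u / 2)) := funext conjKernel_eq
  rw [this]
  fun_prop

lemma continuousOn_conjKernel : ContinuousOn conjKernel (Ioc 0 π) := by
  have : conjKernel = fun u => Real.cos (u / 2) / (2 * Real.sin (u / 2)) := funext conjKernel_eq
  rw [this]
  refine ContinuousOn.div (by fun_prop) (by fun_prop) fun u hu => ?_
  have := Real.sin_pos_of_pos_of_lt_pi (x := u / 2) (by linarith [hu.1]) (by linarith [hu.1, hu.2])
  positivity

lemma conjKernel_nonneg {u : ℝ} (hu : u ∈ Ioc 0 π) : 0 ≤ conjKernel u := by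
  rw [conjKernel_eq]
  have := Real.sin_pos_of_pos_of_lt_pi (x := u / 2) (by linarith [hu.1]) (by linarith [hu.1, hu.2])
  have := Real.cos_nonneg_of_mem_Icc (x := u / 2)
    ⟨by linarith [hu.1, Real.pi_pos], by linarith [hu.2]⟩
  positivity

lemma conjKernel_le {u : ℝ} (hu : u ∈ Ioc 0 π) : conjKernel u ≤ 1 / u := by
  rcases hu.2.eq_or_lt with rfl | h
  · have := Real.pi_pos
    simp [conjKernel, this.le]
  · rw [conjKernel]
    have := Real.lt_tan (x := u / 2) (by linarith [hu.1]) (by linarith)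
    exact one_div_le_one_div_of_le hu.1 (by linarith)

lemma conjKernel_add_conjKernel_pi_sub {u : ℝ} (hu : u ∈ Ioo 0 π) :
    conjKernel u + conjKernel (π - u) = 1 / Real.sin u := by
  have hs := Real.sin_pos_of_pos_of_lt_pi (x := u / 2) (by linarith [hu.1])
    (by linarith [hu.1, hu.2])
  have hc := Real.cos_pos_of_mem_Ioo (x := u / 2)
    ⟨by linarith [hu.1, Real.pi_pos], by linarith [hu.2]⟩
  have h2 : Real.sin u = 2 * Real.sin (u / 2) * Real.cos (u / 2) := by
    rw [← Real.sin_two_mul]; congr 1; ring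
  have h3 : (π - u) / 2 = π / 2 - u / 2 := by ring
  rw [conjKernel_eq, conjKernel_eq, h3, Real.cos_pi_div_two_sub, Real.sin_pi_div_two_sub, h2]
  field_simp
  linarith [Real.sin_sq_add_cos_sq (u / 2)]

lemma DiniCondition.integrableOn {ω : ℝ → ℝ} (hω : Continuous ω) (hd : DiniCondition ω) (b : ℝ) :
    IntegrableOn (fun t => ω t / t) (Ioc 0 b) := by
  obtain ⟨ε, hε, h⟩ := hd
  have h2 : IntegrableOn (fun t => ω t / t) (Icc (ε / 2) b) :=
    ContinuousOn.integrableOn_Icc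
      (hω.continuousOn.div continuousOn_id fun t ht => (lt_of_lt_of_le (half_pos hε) ht.1).ne')
  refine (h.union h2).mono_set fun t ht => ?_
  by_cases h' : t < ε
  · exact Or.inl ⟨ht.1, h'⟩
  · exact Or.inr ⟨by linarith, ht.2⟩

lemma MemH.continuous {ω f : ℝ → ℝ} (hω : IsConcaveModulus ω) (hf : MemH ω f) : Continuous f := by
  rw [continuous_iff_continuousAt]
  intro x
  rw [ContinuousAt, tendsto_iff_dist_tendsto_zero]
  refine squeeze_zero (g := fun y => ω |y - x|) (fun _ => dist_nonneg) (fun y => hf.2 y x) ?_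
  have hc : Continuous fun y => ω |y - x| := hω.1.comp (by fun_prop)
  simpa [hω.2.2.1] using hc.tendsto x

lemma MemH.abs_sub_le {ω f : ℝ → ℝ} (hf : MemH ω f) (x : ℝ) {u : ℝ} (hu : 0 ≤ u) :
    |f (x + u) - f (x - u)| ≤ ω (2 * u) := by
  have := hf.2 (x + u) (x - u)
  rwa [show x + u - (x - u) = 2 * u by ring, abs_of_nonneg (by positivity : 0 ≤ 2 * u)] at this

lemma MemH.abs_sub_pi_sub_le {ω f : ℝ → ℝ} (hf : MemH ω f) (x : ℝ) {u : ℝ} (hu : 0 ≤ u) :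
    |f (x + (π - u)) - f (x - (π - u))| ≤ ω (2 * u) := by
  have := hf.2 (x + (π - u)) (x - (π - u) + 2 * π)
  rwa [hf.1, show x + (π - u) - (x - (π - u) + 2 * π) = -(2 * u) by ring, abs_neg,
    abs_of_nonneg (by positivity : 0 ≤ 2 * u)] at this

lemma IsConcaveModulus.map_two_mul_le {ω : ℝ → ℝ} (hω : IsConcaveModulus ω) {u : ℝ} (hu : 0 ≤ u) :
    ω (2 * u) ≤ 2 * ω u := by
  have := hω.2.2.2.1 u u hu hu
  rw [two_mul, two_mul]; exact this

lemma MemH.intervalIntegrable {ω f : ℝ → ℝ} (hω : IsConcaveModulus ω) (hd : DiniCondition ω)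
    (hf : MemH ω f) (x : ℝ) :
    IntervalIntegrable (fun u => (f (x + u) - f (x - u)) * conjKernel u) volume 0 π := by
  rw [intervalIntegrable_iff_integrableOn_Ioc_of_le Real.pi_pos.le]
  have hc := hf.continuous hω
  refine Integrable.mono' ((hd.integrableOn hω.1 π).const_mul 2) ?_ ?_
  · exact ((by fun_prop : Measurable fun u => f (x + u) - f (x - u)).mul
      measurable_conjKernel).aestronglyMeasurable
  · refine (ae_restrict_iff' measurableSet_Ioc).2 (Eventually.of_forall fun u hu => ?_)
    rw [Real.norm_eq_abs, abs_mul, abs_of_nonneg (conjKernel_nonneg hu)]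
    calc |f (x + u) - f (x - u)| * conjKernel u ≤ (2 * ω u) * (1 / u) :=
          mul_le_mul ((hf.abs_sub_le x hu.1.le).trans (hω.map_two_mul_le hu.1.le))
            (conjKernel_le hu) (conjKernel_nonneg hu)
            (mul_nonneg zero_le_two (hω.2.2.2.2.1 u hu.1.le))
      _ = 2 * (ω u / u) := by ring

lemma IsConcaveModulus.intervalIntegrable {ω : ℝ → ℝ} (hω : IsConcaveModulus ω)
    (hd : DiniCondition ω) :
    IntervalIntegrable (fun u => ω (2 * u) / Real.sin u) volume 0 (π / 2) := by
  rw [intervalIntegrable_iff_integrableOn_Ioc_of_le (by positivity)]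
  have hc := hω.1
  refine Integrable.mono' ((hd.integrableOn hω.1 (π / 2)).const_mul π) ?_ ?_
  · exact (by fun_prop : Measurable fun u => ω (2 * u) / Real.sin u).aestronglyMeasurable
  · refine (ae_restrict_iff' measurableSet_Ioc).2 (Eventually.of_forall fun u hu => ?_)
    have hu0 : 0 < u := hu.1
    have hs : 2 / π * u ≤ Real.sin u := Real.mul_le_sin hu.1.le hu.2
    have hp : 0 < 2 / π * u := by positivity
    have h0 := hω.2.2.2.2.1 (2 * u) (by positivity)
    rw [Real.norm_eq_abs, abs_of_nonneg (div_nonneg h0 (hp.le.trans hs))]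
    calc ω (2 * u) / Real.sin u ≤ (2 * ω u) / (2 / π * u) :=
          div_le_div₀ (mul_nonneg zero_le_two (hω.2.2.2.2.1 u hu0.le))
            (hω.map_two_mul_le hu0.le) hp hs
      _ = π * (ω u / u) := by have := Real.pi_pos; field_simp

lemma setIntegral_conjKernel_eq {f : ℝ → ℝ} (hf : Continuous f) (x : ℝ) {δ : ℝ} (hδ : 0 < δ)
    (hδπ : δ ≤ π) :
    ∫ t in {t : ℝ | δ ≤ |t - x| ∧ |t - x| ≤ π}, f t / (2 * Real.tan ((t - x) / 2)) =
      ∫ u in δ..π, (f (x + u) - f (x - u)) * conjKernel u := by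
  have hset : {t : ℝ | δ ≤ |t - x| ∧ |t - x| ≤ π} =
      Icc (x - π) (x - δ) ∪ Icc (x + δ) (x + π) := by
    ext t
    simp only [mem_ofPred_eq, mem_union, mem_Icc, le_abs, abs_le]
    constructor
    · rintro ⟨h | h, h1, h2⟩
      · exact Or.inr ⟨by linarith, by linarith⟩
      · exact Or.inl ⟨by linarith, by linarith⟩
    · rintro (⟨h1, h2⟩ | ⟨h1, h2⟩)
      · exact ⟨Or.inr (by linarith), by linarith, by linarith⟩
      · exact ⟨Or.inl (by linarith), by linarith, by linarith⟩
  have hdisj : Disjoint (Icc (x - π) (x - δ)) (Icc (x + δ) (x + π)) := by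
    rw [Set.disjoint_left]
    intro t h1 h2
    linarith [h1.2, h2.1]
  have hfun : (fun t => f t / (2 * Real.tan ((t - x) / 2))) =
      fun t => f t * conjKernel (t - x) := by
    funext t; rw [conjKernel, mul_one_div]
  have hKr : ContinuousOn (fun t => f t * conjKernel (t - x)) (Icc (x + δ) (x + π)) :=
    hf.continuousOn.mul (continuousOn_conjKernel.comp (by fun_prop) fun t ht =>
      ⟨by linarith [ht.1], by linarith [ht.2]⟩)
  have hKl : ContinuousOn (fun t => f t * conjKernel (t - x)) (Icc (x - π) (x - δ)) := by
    have : (fun t => f t * conjKernel (t - x)) = fun t => f t * -conjKernel (x - t) := by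
      funext t; rw [← conjKernel_neg, neg_sub]
    rw [this]
    exact hf.continuousOn.mul (continuousOn_conjKernel.comp (by fun_prop) fun t ht =>
      ⟨by linarith [ht.2], by linarith [ht.1]⟩).neg
  have hK : ContinuousOn conjKernel (uIcc δ π) := by
    rw [uIcc_of_le hδπ]
    exact continuousOn_conjKernel.mono fun u hu => ⟨by linarith [hu.1], hu.2⟩
  rw [hfun, hset, setIntegral_union hdisj measurableSet_Icc hKl.integrableOn_Icc
    hKr.integrableOn_Icc, integral_Icc_eq_integral_Ioc, integral_Icc_eq_integral_Ioc,
    ← intervalIntegral.integral_of_le (by linarith), ← intervalIntegral.integral_of_le (by linarith),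
    ← intervalIntegral.integral_comp_sub_left (fun t => f t * conjKernel (t - x)) x,
    ← intervalIntegral.integral_comp_add_left (fun t => f t * conjKernel (t - x)) x,
    ← intervalIntegral.integral_add]
  · refine intervalIntegral.integral_congr fun u _ => ?_
    simp only [add_sub_cancel_left, sub_sub_cancel_left, conjKernel_neg]
    ring
  · refine ContinuousOn.intervalIntegrable ?_
    simp only [sub_sub_cancel_left, conjKernel_neg]
    exact ContinuousOn.mul (by fun_prop) hK.neg
  · refine ContinuousOn.intervalIntegrable ?_
    simp only [add_sub_cancel_left]
    exact ContinuousOn.mul (by fun_prop) hK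

lemma MemH.conjAt {ω f : ℝ → ℝ} (hω : IsConcaveModulus ω) (hd : DiniCondition ω)
    (hf : MemH ω f) (x : ℝ) :
    ConjAt f x (-(1 / π) * ∫ u in (0 : ℝ)..π, (f (x + u) - f (x - u)) * conjKernel u) := by
  refine Tendsto.const_mul _ ?_
  have hc := intervalIntegral.continuousOn_primitive_interval_left
    (f := fun u => (f (x + u) - f (x - u)) * conjKernel u) (μ := volume) (a := 0) (b := π) (by
      rw [uIcc_of_le Real.pi_pos.le, integrableOn_Icc_iff_integrableOn_Ioc,
        ← intervalIntegrable_iff_integrableOn_Ioc_of_le Real.pi_pos.le]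
      exact hf.intervalIntegrable hω hd x)
  rw [uIcc_of_le Real.pi_pos.le] at hc
  have ht := (hc 0 ⟨le_rfl, Real.pi_pos.le⟩).tendsto
  have hle : nhdsWithin (0 : ℝ) (Ioi 0) ≤ nhdsWithin 0 (Icc 0 π) := by
    rw [← nhdsWithin_Ioc_eq_nhdsGT Real.pi_pos]
    exact nhdsWithin_mono _ Ioc_subset_Icc_self
  refine (ht.mono_left hle).congr' ?_
  filter_upwards [Ioc_mem_nhdsGT Real.pi_pos] with δ hδ
  exact (setIntegral_conjKernel_eq (hf.continuous hω) x hδ.1 hδ.2).symm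

lemma integral_zero_pi_eq_fold {h : ℝ → ℝ} (hh : IntervalIntegrable h volume 0 π) :
    IntervalIntegrable (fun u => h u + h (π - u)) volume 0 (π / 2) ∧
    ∫ u in (0 : ℝ)..π, h u = ∫ u in (0 : ℝ)..(π / 2), (h u + h (π - u)) := by
  have hp := Real.pi_pos
  have h1 : IntervalIntegrable h volume 0 (π / 2) := hh.mono_set (by
    rw [uIcc_of_le (by positivity), uIcc_of_le (by positivity)]
    exact Icc_subset_Icc le_rfl (by linarith))
  have h2 : IntervalIntegrable h volume (π / 2) π := hh.mono_set (by
    rw [uIcc_of_le (by linarith), uIcc_of_le (by positivity)]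
    exact Icc_subset_Icc (by positivity) le_rfl)
  have h3 : IntervalIntegrable (fun u => h (π - u)) volume 0 (π / 2) := by
    have := (h2.comp_sub_left π).symm
    rwa [sub_self, sub_half] at this
  refine ⟨h1.add h3, ?_⟩
  rw [intervalIntegral.integral_add h1 h3, intervalIntegral.integral_comp_sub_left h π, sub_zero,
    sub_half, intervalIntegral.integral_add_adjacent_intervals h1 h2]

lemma MemH.abs_conj_le {ω f : ℝ → ℝ} (hω : IsConcaveModulus ω) (hd : DiniCondition ω)
    (hf : MemH ω f) (x : ℝ) :
    |-(1 / π) * ∫ u in (0 : ℝ)..π, (f (x + u) - f (x - u)) * conjKernel u| ≤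
      (1 / π) * ∫ t in (0 : ℝ)..(π / 2), ω (2 * t) / Real.sin t := by
  have hp := Real.pi_pos
  rw [abs_mul, abs_neg, abs_of_pos (by positivity : 0 < 1 / π)]
  refine mul_le_mul_of_nonneg_left ?_ (by positivity)
  obtain ⟨-, hfold⟩ := integral_zero_pi_eq_fold (hf.intervalIntegrable hω hd x)
  rw [hfold, ← Real.norm_eq_abs]
  refine intervalIntegral.norm_integral_le_of_norm_le (by positivity)
    (Eventually.of_forall fun u hu => ?_) (hω.intervalIntegrable hd)
  have h1 : u ∈ Ioc 0 π := ⟨hu.1, by linarith [hu.2]⟩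
  have h2 : π - u ∈ Ioc 0 π := ⟨by linarith [hu.2], by linarith [hu.1]⟩
  calc ‖_‖ ≤ |f (x + u) - f (x - u)| * conjKernel u +
        |f (x + (π - u)) - f (x - (π - u))| * conjKernel (π - u) := by
        refine (norm_add_le _ _).trans_eq ?_
        rw [norm_mul, norm_mul, Real.norm_of_nonneg (conjKernel_nonneg h1),
          Real.norm_of_nonneg (conjKernel_nonneg h2), Real.norm_eq_abs, Real.norm_eq_abs]
    _ ≤ ω (2 * u) * conjKernel u + ω (2 * u) * conjKernel (π - u) :=
        add_le_add
          (mul_le_mul_of_nonneg_right (hf.abs_sub_le x hu.1.le) (conjKernel_nonneg h1))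
          (mul_le_mul_of_nonneg_right (hf.abs_sub_pi_sub_le x hu.1.le) (conjKernel_nonneg h2))
    _ = ω (2 * u) / Real.sin u := by
        rw [← mul_add, conjKernel_add_conjKernel_pi_sub ⟨hu.1, by linarith [h2.1]⟩, mul_one_div]

lemma abs_arcsin_sin_sub_le (x y : ℝ) :
    |Real.arcsin (Real.sin x) - Real.arcsin (Real.sin y)| ≤ |x - y| := by
  have hp := Real.pi_pos
  have ha1 := Real.neg_pi_div_two_le_arcsin (Real.sin x)
  have ha2 := Real.arcsin_le_pi_div_two (Real.sin x)
  have hb1 := Real.neg_pi_div_two_le_arcsin (Real.sin y)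
  have hb2 := Real.arcsin_le_pi_div_two (Real.sin y)
  have hx := Real.sin_arcsin (Real.neg_one_le_sin x) (Real.sin_le_one x)
  have hy := Real.sin_arcsin (Real.neg_one_le_sin y) (Real.sin_le_one y)
  set a := Real.arcsin (Real.sin x)
  set b := Real.arcsin (Real.sin y)
  obtain ⟨k, hk⟩ := Real.sin_eq_sin_iff.1 hx
  obtain ⟨l, hl⟩ := Real.sin_eq_sin_iff.1 hy
  have nonneg {z : ℤ} (hz : 0 ≤ z) : 0 ≤ (z : ℝ) * π := by
    have : (0 : ℝ) ≤ z := by exact_mod_cast hz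
    positivity
  have pos {z : ℤ} (hz : 1 ≤ z) : π ≤ (z : ℝ) * π := by
    have : (1 : ℝ) ≤ z := by exact_mod_cast hz
    nlinarith
  rw [abs_le]
  rcases hk with hk | hk <;> rcases hl with hl | hl
  · rcases lt_trichotomy k l with h | h | h
    · have := pos (z := l - k) (by omega)
      push_cast at this
      cases abs_cases (x - y) <;> constructor <;> linarith
    · subst h
      cases abs_cases (x - y) <;> constructor <;> linarith
    · have := pos (z := k - l) (by omega)
      push_cast at this
      cases abs_cases (x - y) <;> constructor <;> linarith
  · rcases le_or_gt k l with h | h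
    · have := nonneg (z := l - k) (by omega)
      push_cast at this
      cases abs_cases (x - y) <;> constructor <;> linarith
    · have := pos (z := k - l) (by omega)
      push_cast at this
      cases abs_cases (x - y) <;> constructor <;> linarith
  · rcases le_or_gt l k with h | h
    · have := nonneg (z := k - l) (by omega)
      push_cast at this
      cases abs_cases (x - y) <;> constructor <;> linarith
    · have := pos (z := l - k) (by omega)
      push_cast at this
      cases abs_cases (x - y) <;> constructor <;> linarith
  · rcases lt_trichotomy k l with h | h | h
    · have := pos (z := l - k) (by omega)
      push_cast at this
      cases abs_cases (x - y) <;> constructor <;> linarith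
    · subst h
      cases abs_cases (x - y) <;> constructor <;> linarith
    · have := pos (z := k - l) (by omega)
      push_cast at this
      cases abs_cases (x - y) <;> constructor <;> linarith

/-- The odd function equal to `ω (2 s) / 2` for `s ≥ 0`. -/
def oddHalf (ω : ℝ → ℝ) (s : ℝ) : ℝ := (ω (2 * max s 0) - ω (2 * max (-s) 0)) / 2

lemma oddHalf_neg (ω : ℝ → ℝ) (s : ℝ) : oddHalf ω (-s) = -oddHalf ω s := by
  simp only [oddHalf, neg_neg]; ring

lemma IsConcaveModulus.oddHalf_of_nonneg {ω : ℝ → ℝ} (hω : IsConcaveModulus ω) {s : ℝ}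
    (hs : 0 ≤ s) : oddHalf ω s = ω (2 * s) / 2 := by
  rw [oddHalf, max_eq_left hs, max_eq_right (by linarith), mul_zero, hω.2.2.1, sub_zero]

lemma IsConcaveModulus.monotone_oddHalf {ω : ℝ → ℝ} (hω : IsConcaveModulus ω) :
    Monotone (oddHalf ω) := by
  intro s t hst
  have h1 : ω (2 * max s 0) ≤ ω (2 * max t 0) :=
    hω.2.1 (by simp) (by simp) (by gcongr)
  have h2 : ω (2 * max (-t) 0) ≤ ω (2 * max (-s) 0) :=
    hω.2.1 (by simp) (by simp) (by gcongr)
  simp only [oddHalf]; linarith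

lemma IsConcaveModulus.oddHalf_sub_le {ω : ℝ → ℝ} (hω : IsConcaveModulus ω) {s t : ℝ}
    (hst : s ≤ t) : oddHalf ω t - oddHalf ω s ≤ ω (t - s) := by
  have same {p q : ℝ} (hp : 0 ≤ p) (hpq : p ≤ q) : oddHalf ω q - oddHalf ω p ≤ ω (q - p) := by
    rw [hω.oddHalf_of_nonneg hp, hω.oddHalf_of_nonneg (hp.trans hpq)]
    have h1 := hω.2.2.2.1 (2 * p) (2 * (q - p)) (by linarith) (by linarith)
    rw [show 2 * p + 2 * (q - p) = 2 * q by ring] at h1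
    have h2 := hω.map_two_mul_le (sub_nonneg.2 hpq)
    linarith
  rcases le_total 0 s with hs | hs
  · exact same hs hst
  rcases le_total t 0 with ht | ht
  · have := same (p := -t) (q := -s) (by linarith) (by linarith)
    rw [oddHalf_neg, oddHalf_neg] at this
    rw [show t - s = -s - -t by ring]
    linarith
  · have h1 := hω.oddHalf_of_nonneg ht
    have h2 := hω.oddHalf_of_nonneg (s := -s) (by linarith)
    rw [oddHalf_neg] at h2
    have h3 := hω.2.2.2.2.2.2 (mem_Ici.2 (by linarith : 0 ≤ 2 * t))
      (mem_Ici.2 (by linarith : 0 ≤ 2 * -s))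
      (by norm_num : (0 : ℝ) ≤ 1 / 2) (by norm_num : (0 : ℝ) ≤ 1 / 2) (by norm_num)
    simp only [smul_eq_mul] at h3
    rw [show 1 / 2 * (2 * t) + 1 / 2 * (2 * -s) = t - s by ring] at h3
    linarith

lemma IsConcaveModulus.abs_oddHalf_sub_le {ω : ℝ → ℝ} (hω : IsConcaveModulus ω) (s t : ℝ) :
    |oddHalf ω s - oddHalf ω t| ≤ ω |s - t| := by
  rcases le_total s t with h | h
  · rw [abs_sub_comm, abs_sub_comm s, abs_of_nonneg (sub_nonneg.2 (hω.monotone_oddHalf h)),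
      abs_of_nonneg (sub_nonneg.2 h)]
    exact hω.oddHalf_sub_le h
  · rw [abs_of_nonneg (sub_nonneg.2 (hω.monotone_oddHalf h)), abs_of_nonneg (sub_nonneg.2 h)]
    exact hω.oddHalf_sub_le h

/-- The extremal function: odd, `2π`-periodic, symmetric about `π / 2`, and equal to
`ω (2 x) / 2` on `[0, π / 2]`. -/
def conjExtremal (ω : ℝ → ℝ) (x : ℝ) : ℝ := oddHalf ω (Real.arcsin (Real.sin x))

lemma conjExtremal_neg (ω : ℝ → ℝ) (x : ℝ) : conjExtremal ω (-x) = -conjExtremal ω x := by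
  rw [conjExtremal, Real.sin_neg, Real.arcsin_neg, oddHalf_neg, conjExtremal]

lemma conjExtremal_pi_sub (ω : ℝ → ℝ) (x : ℝ) : conjExtremal ω (π - x) = conjExtremal ω x := by
  rw [conjExtremal, Real.sin_pi_sub, conjExtremal]

lemma IsConcaveModulus.conjExtremal_eq {ω : ℝ → ℝ} (hω : IsConcaveModulus ω) {x : ℝ}
    (hx : x ∈ Icc 0 (π / 2)) : conjExtremal ω x = ω (2 * x) / 2 := by
  rw [conjExtremal, Real.arcsin_sin (by linarith [hx.1, Real.pi_pos]) hx.2,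
    hω.oddHalf_of_nonneg hx.1]

lemma IsConcaveModulus.memH_conjExtremal {ω : ℝ → ℝ} (hω : IsConcaveModulus ω) :
    MemH ω (conjExtremal ω) := by
  refine ⟨fun x => by rw [conjExtremal, Real.sin_add_two_pi, conjExtremal], fun x y => ?_⟩
  exact (hω.abs_oddHalf_sub_le _ _).trans
    (hω.2.1 (mem_Ici.2 (abs_nonneg _)) (mem_Ici.2 (abs_nonneg _)) (abs_arcsin_sin_sub_le x y))

lemma IsConcaveModulus.integral_conjExtremal {ω : ℝ → ℝ} (hω : IsConcaveModulus ω) :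
    ∫ t in (0 : ℝ)..(2 * π), conjExtremal ω t = 0 := by
  have h1 := hω.memH_conjExtremal.1.intervalIntegral_add_eq 0 (-π)
  rw [zero_add, show -π + 2 * π = π by ring] at h1
  have h2 := intervalIntegral.integral_comp_neg (a := -π) (b := π) (conjExtremal ω)
  simp only [conjExtremal_neg, intervalIntegral.integral_neg, neg_neg] at h2
  linarith

lemma IsConcaveModulus.integral_conjExtremal_kernel {ω : ℝ → ℝ} (hω : IsConcaveModulus ω)
    (hd : DiniCondition ω) :
    ∫ u in (0 : ℝ)..π, (conjExtremal ω (0 + u) - conjExtremal ω (0 - u)) * conjKernel u =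
      ∫ t in (0 : ℝ)..(π / 2), ω (2 * t) / Real.sin t := by
  have hp := Real.pi_pos
  obtain ⟨-, hfold⟩ := integral_zero_pi_eq_fold (hω.memH_conjExtremal.intervalIntegrable hω hd 0)
  rw [hfold, intervalIntegral.integral_of_le (by positivity),
    intervalIntegral.integral_of_le (by positivity)]
  refine setIntegral_congr_fun measurableSet_Ioc fun u hu => ?_
  simp only [zero_add, zero_sub, conjExtremal_neg, conjExtremal_pi_sub,
    hω.conjExtremal_eq ⟨hu.1.le, hu.2⟩]
  rw [← mul_add, conjKernel_add_conjKernel_pi_sub ⟨hu.1, by linarith [hu.2]⟩]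
  ring

/-- the sup-norm bound is sharp. -/
theorem conj_sup_bound_sharp (ω : ℝ → ℝ) (hω : IsConcaveModulus ω) (hd : DiniCondition ω) :
    (∀ f g : ℝ → ℝ, MemH ω f → (∫ t in (0:ℝ)..(2 * π), f t) = 0 → ConjFn f g →
      ∀ x : ℝ, |g x| ≤ (1 / π) * ∫ t in (0:ℝ)..(π / 2), ω (2 * t) / Real.sin t) ∧
    (∃ f g : ℝ → ℝ, MemH ω f ∧ (∫ t in (0:ℝ)..(2 * π), f t) = 0 ∧ ConjFn f g ∧
      sSup (Set.range fun x => |g x|) =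
        (1 / π) * ∫ t in (0:ℝ)..(π / 2), ω (2 * t) / Real.sin t) := by
  refine ⟨fun f g hf _ hg x => ?_, conjExtremal ω,
    fun x => -(1 / π) * ∫ u in (0 : ℝ)..π,
      (conjExtremal ω (x + u) - conjExtremal ω (x - u)) * conjKernel u,
    hω.memH_conjExtremal, hω.integral_conjExtremal,
    fun x => hω.memH_conjExtremal.conjAt hω hd x, ?_⟩
  · rw [tendsto_nhds_unique (hg x) (hf.conjAt hω hd x)]
    exact hf.abs_conj_le hω hd x
  · refine IsGreatest.csSup_eq ⟨⟨0, ?_⟩, ?_⟩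
    · have hp := Real.pi_pos
      simp only [hω.integral_conjExtremal_kernel hd]
      rw [neg_mul, abs_neg, abs_of_nonneg]
      refine mul_nonneg (by positivity)
        (intervalIntegral.integral_nonneg (by positivity) fun u hu => ?_)
      exact div_nonneg (hω.2.2.2.2.1 _ (by linarith [hu.1]))
        (Real.sin_nonneg_of_nonneg_of_le_pi hu.1 (by linarith [hu.2]))
    · rintro _ ⟨x, rfl⟩
      exact hω.memH_conjExtremal.abs_conj_le hω hd x
end
end

section
/- For the modulus of continuity ω(t) = -1/ln t (near 0), the supremum over f ∈ H_ω with zero mean of ‖f̃‖_C is infinite: there exist functions f ∈ H_ω whose conjugate function is unbounded. -/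
open MeasureTheory Real Filter Set

noncomputable section

/-- The kernel of the conjugate function is dominated by `1 / |u|` on `[-π, π]`. -/
lemma abs_inv_two_mul_tan_half_le {u : ℝ} (hu : |u| ≤ π) :
    |(2 * Real.tan (u / 2))⁻¹| ≤ |u|⁻¹ := by
  wlog h : 0 ≤ u generalizing u
  · have := this (u := -u) (by rwa [abs_neg]) (by linarith)
    rwa [neg_div, Real.tan_neg, mul_neg, inv_neg, abs_neg, abs_neg] at this
  rw [abs_of_nonneg h] at hu ⊢
  rcases hu.eq_or_lt with rfl | hlt
  · simp only [Real.tan_pi_div_two, mul_zero, inv_zero, abs_zero]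
    positivity
  rcases h.eq_or_lt with rfl | hpos
  · simp
  have h1 : u / 2 < Real.tan (u / 2) := Real.lt_tan (by linarith) (by linarith)
  rw [abs_of_nonneg (by apply inv_nonneg.2; linarith)]
  exact inv_anti₀ hpos (by linarith)

lemma measurable_conj_kernel (x : ℝ) :
    Measurable fun t : ℝ => (2 * Real.tan ((t - x) / 2))⁻¹ := by
  simp only [Real.tan_eq_sin_div_cos]
  fun_prop

lemma measurableSet_annulus (δ x : ℝ) :
    MeasurableSet {t : ℝ | δ ≤ |t - x| ∧ |t - x| ≤ π} := by
  have hm : Measurable fun t : ℝ => |t - x| := by fun_prop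
  exact (measurableSet_le measurable_const hm).inter (measurableSet_le hm measurable_const)

lemma setOf_abs_sub_le_eq_Icc (x r : ℝ) : {t : ℝ | |t - x| ≤ r} = Icc (x - r) (x + r) := by
  ext t
  simp only [mem_ofPred_eq, mem_Icc, abs_le]
  constructor <;> rintro ⟨h1, h2⟩ <;> constructor <;> linarith

lemma integrableOn_of_abs_le {h : ℝ → ℝ} {x C : ℝ} {s : Set ℝ} (hm : Measurable h)
    (hs : MeasurableSet s) (hsub : s ⊆ {t : ℝ | |t - x| ≤ π}) (hC : ∀ t ∈ s, |h t| ≤ C) :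
    IntegrableOn h s := by
  rw [setOf_abs_sub_le_eq_Icc] at hsub
  refine IntegrableOn.of_bound ?_ hm.aestronglyMeasurable C ?_
  · exact (measure_mono hsub).trans_lt (by simp)
  · exact (ae_restrict_iff' hs).2 (Eventually.of_forall hC)

/-- The conjugation kernel integrates to zero over symmetric annuli. -/
lemma integral_conj_kernel_annulus (δ x : ℝ) :
    ∫ t in {t : ℝ | δ ≤ |t - x| ∧ |t - x| ≤ π}, (2 * Real.tan ((t - x) / 2))⁻¹ = 0 := by
  rw [← integral_indicator (measurableSet_annulus δ x)]
  set F := indicator {t : ℝ | δ ≤ |t - x| ∧ |t - x| ≤ π}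
    fun t => (2 * Real.tan ((t - x) / 2))⁻¹ with hF
  have hodd : ∀ t, F (2 * x - t) = -F t := by
    intro t
    have e : 2 * x - t - x = -(t - x) := by ring
    simp only [hF, indicator_apply, mem_ofPred_eq, e, abs_neg, neg_div, Real.tan_neg, mul_neg,
      inv_neg]
    split_ifs <;> simp
  have h1 := integral_sub_left_eq_self F volume (2 * x)
  simp only [hodd, integral_neg] at h1
  linarith

lemma abs_conj_quotient_le {f : ℝ → ℝ} {L : ℝ} (hL : ∀ x y, |f x - f y| ≤ L * |x - y|)
    {x t : ℝ} (ht : |t - x| ≤ π) :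
    |(f t - f x) / (2 * Real.tan ((t - x) / 2))| ≤ L := by
  rcases eq_or_ne t x with rfl | hne
  · have := (abs_nonneg _).trans (hL 1 0)
    simpa using this
  have hpos : 0 < |t - x| := abs_pos.2 (sub_ne_zero.2 hne)
  rw [div_eq_mul_inv, abs_mul]
  calc _ ≤ (L * |t - x|) * |t - x|⁻¹ :=
        mul_le_mul (hL t x) (abs_inv_two_mul_tan_half_le ht) (abs_nonneg _)
          ((abs_nonneg _).trans (hL t x))
    _ = L := by field_simp

lemma measurable_conj_quotient {f : ℝ → ℝ} (hf : Measurable f) (x : ℝ) :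
    Measurable fun t => (f t - f x) / (2 * Real.tan ((t - x) / 2)) := by
  simp only [div_eq_mul_inv _ (2 * Real.tan _)]
  exact (hf.sub_const _).mul (measurable_conj_kernel x)

/-- The conjugate function of a Lipschitz function exists everywhere and is given by an absolutely
convergent integral. -/
lemma conjAt_of_lipschitz {f : ℝ → ℝ} {L : ℝ} (hf : Measurable f)
    (hL : ∀ x y, |f x - f y| ≤ L * |x - y|) (x : ℝ) :
    ConjAt f x (-(1 / π) * ∫ t in {t : ℝ | |t - x| ≤ π},
      (f t - f x) / (2 * Real.tan ((t - x) / 2))) := by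
  set H : ℝ → ℝ := fun t => (f t - f x) / (2 * Real.tan ((t - x) / 2)) with hH
  have hHm : Measurable H := measurable_conj_quotient hf x
  have hS : MeasurableSet {t : ℝ | |t - x| ≤ π} := by
    rw [setOf_abs_sub_le_eq_Icc]; exact measurableSet_Icc
  have hHb : ∀ t, |t - x| ≤ π → |H t| ≤ L := fun t ht => abs_conj_quotient_le hL ht
  have hL0 : 0 ≤ L := (abs_nonneg _).trans (hHb x (by simp [pi_pos.le]))
  refine Tendsto.const_mul _ ?_
  have key : ∀ δ ∈ Ioi (0 : ℝ),
      ∫ t, indicator {t : ℝ | δ ≤ |t - x| ∧ |t - x| ≤ π} H t =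
      ∫ t in {t : ℝ | δ ≤ |t - x| ∧ |t - x| ≤ π}, f t / (2 * Real.tan ((t - x) / 2)) := by
    intro δ hδ
    rw [integral_indicator (measurableSet_annulus δ x)]
    have hk : IntegrableOn (fun t => (2 * Real.tan ((t - x) / 2))⁻¹)
        {t : ℝ | δ ≤ |t - x| ∧ |t - x| ≤ π} :=
      integrableOn_of_abs_le (C := δ⁻¹) (measurable_conj_kernel x) (measurableSet_annulus δ x)
        (fun t ht => ht.2) fun t ht =>
          (abs_inv_two_mul_tan_half_le ht.2).trans (inv_anti₀ hδ ht.1)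
    have hHi : IntegrableOn H {t : ℝ | δ ≤ |t - x| ∧ |t - x| ≤ π} :=
      integrableOn_of_abs_le hHm (measurableSet_annulus δ x) (fun t ht => ht.2)
        fun t ht => hHb t ht.2
    have hsplit : ∀ t, f t / (2 * Real.tan ((t - x) / 2)) =
        H t + f x * (2 * Real.tan ((t - x) / 2))⁻¹ := by
      intro t; simp only [hH]; ring
    simp only [hsplit]
    rw [integral_add hHi (hk.const_mul _), integral_const_mul, integral_conj_kernel_annulus]
    ring
  refine Tendsto.congr' (eventually_nhdsWithin_of_forall key) ?_
  rw [← integral_indicator hS]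
  refine tendsto_integral_filter_of_dominated_convergence
    (indicator {t : ℝ | |t - x| ≤ π} fun _ => L) ?_ ?_ ?_ ?_
  · exact Eventually.of_forall fun δ =>
      (hHm.indicator (measurableSet_annulus δ x)).aestronglyMeasurable
  · refine Eventually.of_forall fun δ => Eventually.of_forall fun t => ?_
    simp only [indicator_apply, mem_ofPred_eq, Real.norm_eq_abs]
    split_ifs with h1 h2 h2
    · exact hHb t h2
    · exact absurd h1.2 h2
    · simpa using hL0
    · simp
  · rw [integrable_indicator_iff hS]
    exact integrableOn_of_abs_le (C := |L|) measurable_const hS subset_rfl fun _ _ => le_rfl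
  · refine Eventually.of_forall fun t => ?_
    rcases eq_or_ne t x with rfl | hne
    · have : H t = 0 := by simp [hH]
      simp [indicator_apply, this]
    · have hpos : 0 < |t - x| := abs_pos.2 (sub_ne_zero.2 hne)
      refine tendsto_const_nhds.congr' ?_
      filter_upwards [nhdsWithin_le_nhds (Iio_mem_nhds hpos)] with δ hδ
      simp only [indicator_apply, mem_ofPred_eq]
      have hδ' : δ ≤ |t - x| := le_of_lt hδ
      simp only [hδ', true_and]
      split_ifs <;> rfl

lemma abs_sin_sub_sin_le_abs_sub (x y : ℝ) : |Real.sin x - Real.sin y| ≤ |x - y| := by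
  have h := Real.lipschitzWith_sin.dist_le_mul x y
  simpa [Real.dist_eq] using h

lemma IsConcaveModulus.abs_sub_le {ω : ℝ → ℝ} (hω : IsConcaveModulus ω) {a b : ℝ}
    (ha : 0 ≤ a) (hb : 0 ≤ b) : |ω a - ω b| ≤ ω |a - b| := by
  obtain ⟨-, hmono, -, hsub, -, -⟩ := hω
  wlog h : b ≤ a generalizing a b
  · rw [abs_sub_comm, abs_sub_comm a]
    exact this hb ha (le_of_not_ge h)
  rw [abs_of_nonneg (sub_nonneg.2 h), abs_of_nonneg (sub_nonneg.2 (hmono hb ha h))]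
  have := hsub b (a - b) hb (sub_nonneg.2 h)
  rw [add_sub_cancel] at this
  linarith

/-- A concave modulus is Lipschitz away from zero. -/
lemma IsConcaveModulus.abs_sub_le_mul {ω : ℝ → ℝ} (hω : IsConcaveModulus ω) {ε a b : ℝ}
    (hε : 0 < ε) (ha : ε ≤ a) (hb : ε ≤ b) : |ω a - ω b| ≤ ω ε / ε * |a - b| := by
  obtain ⟨-, hmono, hzero, -, -, hconc⟩ := hω
  wlog h : b ≤ a generalizing a b
  · rw [abs_sub_comm, abs_sub_comm a]
    exact this hb ha (le_of_not_ge h)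
  have ha0 : (0 : ℝ) ≤ a := hε.le.trans ha
  have hb0 : (0 : ℝ) ≤ b := hε.le.trans hb
  rw [abs_of_nonneg (sub_nonneg.2 h), abs_of_nonneg (sub_nonneg.2 (hmono hb0 ha0 h))]
  have from_eps : ∀ c, ε < c → (ω c - ω ε) / (c - ε) ≤ ω ε / ε := fun c hc => by
    simpa [hzero] using hconc.slope_anti_adjacent (mem_Ici.2 le_rfl)
      (mem_Ici.2 (hε.le.trans hc.le)) hε hc
  rcases h.eq_or_lt with rfl | hlt
  · simp
  rw [← div_le_iff₀ (sub_pos.2 hlt)]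
  rcases hb.eq_or_lt with rfl | hlt'
  · exact from_eps a hlt
  · exact (hconc.slope_anti_adjacent (mem_Ici.2 hε.le) (mem_Ici.2 ha0) hlt' hlt).trans
      (from_eps b hlt')

/-- An odd function, Lipschitz for `ε > 0`, which equals `(ω (s + ε) - ω ε) / 2` for `s ≥ 0`. -/
def oddShift (ω : ℝ → ℝ) (ε s : ℝ) : ℝ := (ω (max s 0 + ε) - ω (max (-s) 0 + ε)) / 2

lemma oddShift_neg (ω : ℝ → ℝ) (ε s : ℝ) : oddShift ω ε (-s) = -oddShift ω ε s := by
  simp only [oddShift, neg_neg]; ring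

lemma oddShift_of_nonneg (ω : ℝ → ℝ) (ε : ℝ) {s : ℝ} (hs : 0 ≤ s) :
    oddShift ω ε s = (ω (s + ε) - ω ε) / 2 := by
  simp [oddShift, max_eq_left hs, max_eq_right (neg_nonpos.2 hs)]

lemma abs_posPart_shift_sub_le (ε s t : ℝ) : |max s 0 + ε - (max t 0 + ε)| ≤ |s - t| := by
  rw [add_sub_add_right_eq_sub]
  exact abs_max_sub_max_le_abs s t 0

lemma abs_oddShift_sub_le_of_shift {ω Φ : ℝ → ℝ} {ε : ℝ} (hΦ : MonotoneOn Φ (Ici 0))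
    (h : ∀ a b, ε ≤ a → ε ≤ b → |ω a - ω b| ≤ Φ |a - b|) (s t : ℝ) :
    |oddShift ω ε s - oddShift ω ε t| ≤ Φ |s - t| := by
  have hP : ∀ s t : ℝ, |ω (max s 0 + ε) - ω (max t 0 + ε)| ≤ Φ |s - t| := fun s t =>
    (h _ _ (by simp) (by simp)).trans
      (hΦ (mem_Ici.2 (abs_nonneg _)) (mem_Ici.2 (abs_nonneg _)) (abs_posPart_shift_sub_le ε s t))
  have h1 := abs_le.1 (hP s t)
  have h2 := hP (-s) (-t)
  rw [neg_sub_neg, abs_sub_comm t s] at h2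
  have h2 := abs_le.1 h2
  simp only [oddShift]
  rw [abs_le]
  constructor <;> linarith [h1.1, h1.2, h2.1, h2.2]

lemma oddShift_sin_div_tan_nonneg {ω : ℝ → ℝ} (hmono : MonotoneOn ω (Ici 0)) {ε : ℝ} (hε : 0 ≤ ε)
    {t : ℝ} (ht : |t| ≤ π) : 0 ≤ oddShift ω ε (Real.sin t) / (2 * Real.tan (t / 2)) := by
  wlog h : 0 ≤ t generalizing t
  · have := this (t := -t) (by rwa [abs_neg]) (by linarith)
    rwa [Real.sin_neg, oddShift_neg, neg_div 2 t, Real.tan_neg, mul_neg, neg_div_neg_eq] at this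
  rw [abs_of_nonneg h] at ht
  have hs := Real.sin_nonneg_of_nonneg_of_le_pi h ht
  have htan := Real.tan_nonneg_of_nonneg_of_le_pi_div_two (x := t / 2) (by linarith) (by linarith)
  rw [oddShift_of_nonneg ω ε hs]
  have := hmono (mem_Ici.2 hε) (mem_Ici.2 (add_nonneg hs hε)) (by linarith)
  exact div_nonneg (by linarith) (by linarith)

lemma le_oddShift_sin_div_tan {ω : ℝ → ℝ} (hω : IsConcaveModulus ω) {ε t : ℝ} (hε : 0 ≤ ε)
    (ht : 0 < t) (ht1 : t ≤ 1) (hεt : ω ε ≤ ω t / 4) :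
    ω t / t / 16 ≤ oddShift ω ε (Real.sin t) / (2 * Real.tan (t / 2)) := by
  obtain ⟨-, hmono, -, hsub, hnn, -⟩ := hω
  have hpi := Real.pi_gt_three
  have hsin : t / 2 ≤ Real.sin t := by
    have := Real.mul_le_sin ht.le (by linarith)
    refine le_trans ?_ this
    rw [div_eq_inv_mul]
    refine mul_le_mul_of_nonneg_right ?_ ht.le
    rw [inv_eq_one_div, div_le_div_iff₀ (by norm_num) pi_pos]
    linarith [Real.pi_le_four]
  have hs0 : 0 ≤ Real.sin t := by linarith
  have hhalf : ω t ≤ 2 * ω (t / 2) := by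
    have := hsub (t / 2) (t / 2) (by linarith) (by linarith)
    rw [add_halves] at this
    linarith
  have hω1 : ω (t / 2) ≤ ω (Real.sin t + ε) :=
    hmono (mem_Ici.2 (by linarith)) (mem_Ici.2 (by linarith)) (by linarith)
  have htan0 : 0 < Real.tan (t / 2) := Real.tan_pos_of_pos_of_lt_pi_div_two (by linarith) (by linarith)
  have htan : Real.tan (t / 2) ≤ t := by
    have hc : 1 / 2 ≤ Real.cos (t / 2) := by
      have := Real.one_sub_sq_div_two_le_cos (x := t / 2)
      nlinarith
    rw [Real.tan_eq_sin_div_cos, div_le_iff₀ (by linarith)]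
    have := Real.sin_le (x := t / 2) (by linarith)
    nlinarith
  rw [oddShift_of_nonneg ω ε hs0, div_div, div_le_div_iff₀ (by linarith) (by linarith)]
  have h0 := hnn t ht.le
  have : ω t / 8 ≤ (ω (Real.sin t + ε) - ω ε) / 2 := by linarith
  calc ω t * (2 * Real.tan (t / 2)) ≤ ω t * (2 * t) := by gcongr
    _ = ω t / 8 * (t * 16) := by ring
    _ ≤ _ := by gcongr

lemma memH_oddShift_sin {ω : ℝ → ℝ} (hω : IsConcaveModulus ω) {ε : ℝ} (hε : 0 ≤ ε) :
    MemH ω fun t => oddShift ω ε (Real.sin t) := by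
  refine ⟨fun t => by simp only [Real.sin_add_two_pi], fun x y => ?_⟩
  refine (abs_oddShift_sub_le_of_shift hω.2.1
    (fun a b ha hb => hω.abs_sub_le (hε.trans ha) (hε.trans hb)) _ _).trans ?_
  exact hω.2.1 (mem_Ici.2 (abs_nonneg _)) (mem_Ici.2 (abs_nonneg _)) (abs_sin_sub_sin_le_abs_sub x y)

lemma abs_oddShift_sin_sub_le {ω : ℝ → ℝ} (hω : IsConcaveModulus ω) {ε : ℝ} (hε : 0 < ε)
    (x y : ℝ) :
    |oddShift ω ε (Real.sin x) - oddShift ω ε (Real.sin y)| ≤ ω ε / ε * |x - y| := by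
  have hK : 0 ≤ ω ε / ε := div_nonneg (hω.2.2.2.2.1 ε hε.le) hε.le
  refine (abs_oddShift_sub_le_of_shift (Φ := fun u => ω ε / ε * u)
    (fun a _ b _ hab => mul_le_mul_of_nonneg_left hab hK)
    (fun a b ha hb => hω.abs_sub_le_mul hε ha hb) _ _).trans ?_
  exact mul_le_mul_of_nonneg_left (abs_sin_sub_sin_le_abs_sub x y) hK

lemma integral_oddShift_sin (ω : ℝ → ℝ) (ε : ℝ) :
    ∫ t in (0 : ℝ)..(2 * π), oddShift ω ε (Real.sin t) = 0 := by
  have h := intervalIntegral.integral_comp_sub_left (a := 0) (b := 2 * π)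
    (fun t => oddShift ω ε (Real.sin t)) (2 * π)
  simp only [Real.sin_two_pi_sub, oddShift_neg, sub_self, sub_zero,
    intervalIntegral.integral_neg] at h
  linarith

lemma integral_neg_inv_log_div {δ a : ℝ} (hδ : 0 < δ) (hδa : δ ≤ a) (ha : a < 1) :
    IntervalIntegrable (fun t => -1 / Real.log t / t) volume δ a ∧
    ∫ t in δ..a, -1 / Real.log t / t =
      Real.log (-Real.log δ) - Real.log (-Real.log a) := by
  have hmem : ∀ t ∈ uIcc δ a, 0 < t ∧ Real.log t < 0 := by
    intro t ht
    rw [uIcc_of_le hδa] at ht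
    have h0 : 0 < t := hδ.trans_le ht.1
    exact ⟨h0, Real.log_neg h0 (ht.2.trans_lt ha)⟩
  have hint : IntervalIntegrable (fun t => -1 / Real.log t / t) volume δ a := by
    refine ContinuousOn.intervalIntegrable ?_
    refine (continuousOn_const.div (Real.continuousOn_log.mono fun t ht => ?_)
      fun t ht => (hmem t ht).2.ne).div continuousOn_id fun t ht => (hmem t ht).1.ne'
    exact (hmem t ht).1.ne'
  refine ⟨hint, ?_⟩
  rw [intervalIntegral.integral_eq_sub_of_hasDerivAt
    (f := fun t => -Real.log (-Real.log t)) (fun t ht => ?_) hint]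
  · ring
  · obtain ⟨h0, h1⟩ := hmem t ht
    have := ((Real.hasDerivAt_log h0.ne').fun_neg.log (by simpa using h1.ne)).fun_neg
    convert this using 1
    field_simp

/-- for ω(t) = -1/ln t, the sup of ‖f̃‖_C over zero-mean f ∈ H_ω is infinite. -/
theorem conj_sup_infinite (ω : ℝ → ℝ) (t₀ : ℝ) (h0 : 0 < t₀) (h1 : t₀ < 1)
    (hlog : ∀ t ∈ Ioc (0:ℝ) t₀, ω t = -1 / Real.log t) (hω : IsConcaveModulus ω) :
    ∀ M : ℝ, ∃ (f g : ℝ → ℝ) (x : ℝ), MemH ω f ∧ (∫ t in (0:ℝ)..(2 * π), f t) = 0 ∧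
      ConjFn f g ∧ M < |g x| := by
  intro M
  set b := Real.log (-Real.log t₀) with hb
  set B := b + 16 * (π * (|M| + 1)) with hB
  set δ := Real.exp (-Real.exp B) with hδ
  have hpi := pi_pos
  have hBb : b < B := by
    have : 0 < 16 * (π * (|M| + 1)) := by positivity
    linarith
  have hlogt : Real.log t₀ < 0 := Real.log_neg h0 h1
  have hδ0 : 0 < δ := Real.exp_pos _
  have hδt : δ < t₀ := by
    have := (Real.log_lt_iff_lt_exp (neg_pos.2 hlogt)).1 hBb
    rw [hδ, ← Real.lt_log_iff_exp_lt h0]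
    linarith
  obtain ⟨hcont, hmono, hzero, -, -, -⟩ := id hω
  have hωδ : 0 < ω δ := by
    rw [hlog δ ⟨hδ0, hδt.le⟩, hδ, Real.log_exp, neg_div_neg_eq]
    positivity
  obtain ⟨ε, hε, hεδ⟩ : ∃ ε > 0, ω ε ≤ ω δ / 4 := by
    have hev : ∀ᶠ ε in nhdsWithin (0 : ℝ) (Ioi 0), ω ε < ω δ / 4 :=
      nhdsWithin_le_nhds (hcont.continuousAt.eventually_lt_const (by rw [hzero]; positivity))
    obtain ⟨ε, h, hpos⟩ := (hev.and self_mem_nhdsWithin).exists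
    exact ⟨ε, hpos, h.le⟩
  set f : ℝ → ℝ := fun t => oddShift ω ε (Real.sin t) with hf
  have hfL : ∀ x y, |f x - f y| ≤ ω ε / ε * |x - y| := abs_oddShift_sin_sub_le hω hε
  have hfm : Measurable f := by
    have hcω := hcont.measurable
    simp only [hf, oddShift]
    fun_prop
  refine ⟨f, fun x => -(1 / π) * ∫ t in {t : ℝ | |t - x| ≤ π},
      (f t - f x) / (2 * Real.tan ((t - x) / 2)), 0, memH_oddShift_sin hω hε.le,
    integral_oddShift_sin ω ε, conjAt_of_lipschitz hfm hfL, ?_⟩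
  have hf0 : f 0 = 0 := by simp [hf, oddShift]
  have hS : {t : ℝ | |t - 0| ≤ π} = Icc (-π) π := by
    rw [setOf_abs_sub_le_eq_Icc, zero_sub, zero_add]
  have hHi : IntegrableOn (fun t => (f t - f 0) / (2 * Real.tan ((t - 0) / 2))) (Icc (-π) π) :=
    integrableOn_of_abs_le (x := 0) (measurable_conj_quotient hfm 0) measurableSet_Icc hS.ge
      fun t ht => abs_conj_quotient_le hfL (by rw [← hS] at ht; exact ht)
  beta_reduce
  rw [hS]
  simp only [hf0, sub_zero] at hHi ⊢
  have hsub : Ioc δ t₀ ⊆ Icc (-π) π := fun t ht =>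
    ⟨by linarith [ht.1], by linarith [ht.2, Real.pi_gt_three]⟩
  obtain ⟨hlogint, hlogval⟩ := integral_neg_inv_log_div hδ0 hδt.le h1
  have hlower : π * (|M| + 1) ≤ ∫ t in Icc (-π) π, f t / (2 * Real.tan (t / 2)) := by
    calc π * (|M| + 1) = (∫ t in δ..t₀, -1 / Real.log t / t) / 16 := by
          rw [hlogval, hδ, Real.log_exp, neg_neg, Real.log_exp, hB]; ring
      _ = ∫ t in Ioc δ t₀, -1 / Real.log t / t / 16 := by
          rw [intervalIntegral.integral_of_le hδt.le, integral_div]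
      _ ≤ ∫ t in Ioc δ t₀, f t / (2 * Real.tan (t / 2)) := by
          refine setIntegral_mono_on
            (((intervalIntegrable_iff_integrableOn_Ioc_of_le hδt.le).1 hlogint).div_const 16)
            (hHi.mono_set hsub) measurableSet_Ioc fun t ht => ?_
          have ht0 : 0 < t := hδ0.trans ht.1
          have hmt : ω δ ≤ ω t := hmono (mem_Ici.2 hδ0.le) (mem_Ici.2 ht0.le) ht.1.le
          rw [← hlog t ⟨ht0, ht.2⟩]
          exact le_oddShift_sin_div_tan hω hε.le ht0 (ht.2.trans h1.le) (by linarith)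
      _ ≤ _ := by
          refine setIntegral_mono_set hHi ?_ hsub.eventuallyLE
          refine (ae_restrict_iff' measurableSet_Icc).2 (Eventually.of_forall fun t ht => ?_)
          exact oddShift_sin_div_tan_nonneg hmono hε.le (abs_le.2 ht)
  rw [abs_mul, abs_neg, abs_of_pos (one_div_pos.2 hpi)]
  calc M < |M| + 1 := by linarith [le_abs_self M]
    _ = 1 / π * (π * (|M| + 1)) := by field_simp
    _ ≤ _ := by gcongr; exact hlower.trans (le_abs_self _)
end
end
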